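/- If γ is a 3-cycle of (R₇, ℤ×R₇) satisfying l(γ) = 7, |T_n(γ)| = 3 and |T_{n+1}(γ)| = 4, where n is the minimal degree of γ, then γ is a 3-boundary. -/

import Mathlib

namespace QHom

variable {X S : Type*}

/-- Generating tuples: an element of `S` together with a list of quandle elements
whose consecutive entries are distinct. -/
abbrev Gen (X S : Type*) := {p : S × List X // p.2.Chain' (· ≠ ·)}

/-- The chain group: the free abelian group on `Gen X S`. -/
abbrev Ch (X S : Type*) := Gen X S →₀ ℤ

/-- The basis chain associated to a tuple; `0` if two consecutive entries coincide. -/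
noncomputable def gen (s : S) (l : List X) : Ch X S := by
  classical
  exact if h : l.Chain' (· ≠ ·) then Finsupp.single ⟨(s, l), h⟩ 1 else 0

noncomputable def fOn (t : Gen X S) : Ch X S :=
  ∑ j : Fin t.1.2.length, ((-1 : ℤ) ^ ((j : ℕ) + 1)) • gen t.1.1 (t.1.2.eraseIdx (j : ℕ))

/-- The map `f`. -/
noncomputable def fmap (γ : Ch X S) : Ch X S := γ.sum fun t c => c • fOn t

noncomputable def gOn (op : X → X → X) (sact : S → X → S) (t : Gen X S) : Ch X S :=
  ∑ j : Fin t.1.2.length,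
    ((-1 : ℤ) ^ (j : ℕ)) •
      gen (sact t.1.1 (t.1.2.get j))
        ((t.1.2.take (j : ℕ)).map (fun x => op x (t.1.2.get j)) ++ t.1.2.drop ((j : ℕ) + 1))

/-- The map `g`. -/
noncomputable def gmap (op : X → X → X) (sact : S → X → S) (γ : Ch X S) : Ch X S :=
  γ.sum fun t c => c • gOn op sact t

/-- The boundary map `∂ = f + g`. -/
noncomputable def bd (op : X → X → X) (sact : S → X → S) (γ : Ch X S) : Ch X S :=
  fmap γ + gmap op sact γ

/-- `γ` is an `m`-chain: it is supported on tuples of length `m`. -/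
def IsMChain (m : ℕ) (γ : Ch X S) : Prop := ∀ t ∈ γ.support, t.1.2.length = m

/-- The length of a chain: the sum of the absolute values of its coefficients. -/
noncomputable def chainLen (γ : Ch X S) : ℕ := γ.sum fun _ c => c.natAbs

/-- `π` : forget the `S`-coordinate. -/
noncomputable def proj (γ : Ch X S) : Ch X Unit := γ.sum fun t c => c • gen () t.1.2

/-- Evaluation of a cochain (given by its values on generating tuples) on a chain. -/
noncomputable def evalCh {A : Type*} [AddCommGroup A] (θ : List X → A) (δ : Ch X Unit) : A :=
  δ.sum fun t c => c • θ t.1.2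

/-- The action of quandle generators on the `X`-set `ℤ × X`. -/
def zact (op : X → X → X) (s : ℤ × X) (a : X) : ℤ × X := (s.1 + 1, op s.2 a)

/-- `γ` is a 3-term of degree `n` and index `u`. -/
def IsTerm3 (γ : Ch X (ℤ × X)) (n : ℤ) (u : X) : Prop :=
  ∃ ε a b c, (ε = (1 : ℤ) ∨ ε = -1) ∧ a ≠ b ∧ b ≠ c ∧ γ = ε • gen (n, u) [a, b, c]

def Efficient {k : ℕ} (γ : Fin k → Ch X S) : Prop := ∀ i j, i ≠ j → γ i ≠ -γ j

def FConnected {k : ℕ} (γ : Fin k → Ch X S) : Prop :=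
  Efficient γ ∧ (∑ i, fmap (γ i)) = 0 ∧
    ∀ I : Finset (Fin k), I.Nonempty → I ≠ Finset.univ → (∑ i ∈ I, fmap (γ i)) ≠ 0

def GConnected {k : ℕ} (op : X → X → X) (sact : S → X → S) (γ : Fin k → Ch X S) : Prop :=
  Efficient γ ∧ (∑ i, gmap op sact (γ i)) = 0 ∧
    ∀ I : Finset (Fin k), I.Nonempty → I ≠ Finset.univ → (∑ i ∈ I, gmap op sact (γ i)) ≠ 0

/-- `n` is the minimal degree of `γ`. -/
def MinDegree (γ : Ch X (ℤ × X)) (n : ℤ) : Prop :=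
  (∃ t ∈ γ.support, t.1.1.1 = n) ∧ ∀ t ∈ γ.support, n ≤ t.1.1.1

/-- `|T_k(γ)|`: the number of terms (with multiplicity) of `γ` of degree `k`. -/
noncomputable def Tcount (γ : Ch X (ℤ × X)) (k : ℤ) : ℕ :=
  γ.sum fun t c => if t.1.1.1 = k then c.natAbs else 0

def revList (op : X → X → X) : List X → List X
  | [] => []
  | a :: l => l.foldl op a :: revList op l

/-- The reverse of a chain of `(X, ℤ × X)` (a chain of the dual quandle). -/
noncomputable def reverse (op : X → X → X) (γ : Ch X (ℤ × X)) : Ch X (ℤ × X) :=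
  γ.sum fun t c => c • gen (-t.1.1.1, t.1.2.foldl op t.1.1.2) (revList op t.1.2)

/-- The degree-shift automorphism `σ`. -/
noncomputable def sigmaMap (γ : Ch X (ℤ × X)) : Ch X (ℤ × X) :=
  γ.sum fun t c => c • gen (t.1.1.1 + 1, t.1.1.2) t.1.2

/-- `γ` is a 3-term of type `ty` with respect to the operation `op`. -/
def IsTypedTerm (op : X → X → X) (γ : Ch X (ℤ × X)) (ty : ℕ) : Prop :=
  ∃ (ε n : ℤ) (u a b c : X), (ε = 1 ∨ ε = -1) ∧ a ≠ b ∧ b ≠ c ∧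
    γ = ε • gen (n, u) [a, b, c] ∧
    ((ty = 0 ∧ a = c ∧ op a b = c) ∨ (ty = 1 ∧ a = c ∧ op a b ≠ c) ∨
      (ty = 2 ∧ a ≠ c ∧ op a b = c) ∨ (ty = 3 ∧ a ≠ c ∧ op a b ≠ c))

/-- A bigon 3-term `⟨x, y⟩` of degree `n` and index `u`. -/
def IsBigon (n : ℤ) (u x y : X) (δ : Ch X (ℤ × X)) : Prop :=
  δ = gen (n, u) [x, y, x] ∨ δ = gen (n, u) [y, x, y]

/-- The case shapes (A), (B), (C). -/
def Shape (δ : Ch X (ℤ × X)) (n : ℤ) (l : ℕ) : Prop :=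
  (4 ≤ l ∧ l ≤ 7 ∧ Tcount δ n = l) ∨
  (6 ≤ l ∧ l ≤ 7 ∧ Tcount δ n = 2 ∧ Tcount δ (n + 1) = l - 2) ∨
  (6 ≤ l ∧ l ≤ 7 ∧ Tcount δ n = 3 ∧ Tcount δ (n + 1) = l - 3)

/-- A quandle structure on `X`. -/
structure QuandleStr (X : Type*) where
  op : X → X → X
  idem : ∀ a, op a a = a
  bij : ∀ b, Function.Bijective fun a => op a b
  dist : ∀ a b c, op (op a b) c = op (op a c) (op b c)

/-- The dual quandle operation. -/
noncomputable def dualOp (Q : QuandleStr X) : X → X → X :=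
  fun a b => (Equiv.ofBijective (fun x => Q.op x b) (Q.bij b)).symm a

/-- An `X`-set: a set with a right action of the associated group `G(X)`, recorded via its
action of the generators, which is bijective generator-wise and compatible with the
defining relations of `G(X)`. -/
structure QSet (X : Type*) (op : X → X → X) (S : Type*) where
  sact : S → X → S
  bij : ∀ a, Function.Bijective fun s => sact s a
  comm : ∀ s a b, sact (sact s a) b = sact (sact s b) (op a b)

/-- The 7-dihedral quandle operation on `ZMod 7`. -/
def R7op : ZMod 7 → ZMod 7 → ZMod 7 := fun a b => 2 * b - a

def zetaInt (a b c : ℤ) : ℤ := (a - b) * ((b ^ 7 + (2 * c - b) ^ 7 - 2 * c ^ 7) / 7)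

/-- The Mochizuki 3-cocycle on triples. -/
def zetaFun (a b c : ZMod 7) : ZMod 7 := (zetaInt a.val b.val c.val : ℤ)

def zetaL : List (ZMod 7) → ZMod 7
  | [a, b, c] => zetaFun a b c
  | _ => 0

/-- The octahedral quandle operation on `Fin 6`: `octAct a b = σ_b(a)`. -/
def octAct : Fin 6 → Fin 6 → Fin 6 := fun a b =>
  ![![0, 2, 4, 3, 5, 1],
    ![5, 1, 0, 2, 4, 3],
    ![1, 3, 2, 4, 0, 5],
    ![0, 5, 1, 3, 2, 4],
    ![2, 1, 3, 5, 4, 0],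
    ![4, 0, 2, 1, 3, 5]] b a

/-- `σ₀`, the rotation about the axis through `0` and `3`. -/
def sig0 : Fin 6 → Fin 6 := fun a => octAct a 0

def etaTriples1 : List (Fin 6 × Fin 6 × Fin 6) :=
  [(0, 1, 2), (0, 3, 1), (1, 2, 0), (1, 4, 2), (3, 1, 5)]

def etaTriples2 : List (Fin 6 × Fin 6 × Fin 6) :=
  [(0, 1, 5), (1, 0, 1), (1, 0, 5), (1, 2, 1), (1, 3, 1), (1, 3, 2), (1, 4, 5), (1, 5, 1),
    (3, 0, 1), (3, 1, 0), (3, 1, 2)]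

/-- The 3-cocycle `η` of the octahedral quandle, on triples. -/
noncomputable def etaFun (a b c : Fin 6) : ZMod 3 := by
  classical
  exact
    if ∃ k : ℕ, ∃ p ∈ etaTriples1, a = sig0^[k] p.1 ∧ b = sig0^[k] p.2.1 ∧ c = sig0^[k] p.2.2
      then 1
    else if ∃ k : ℕ, ∃ p ∈ etaTriples2, a = sig0^[k] p.1 ∧ b = sig0^[k] p.2.1 ∧ c = sig0^[k] p.2.2
      then 2
    else 0

noncomputable def etaL : List (Fin 6) → ZMod 3
  | [a, b, c] => etaFun a b c
  | _ => 0

theorem gen_of_chain (s : S) {l : List X} (h : l.IsChain (· ≠ ·)) :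
    gen s l = Finsupp.single ⟨(s, l), h⟩ 1 :=
  dif_pos h

theorem gen_of_not_chain (s : S) {l : List X} (h : ¬ l.IsChain (· ≠ ·)) : gen s l = 0 :=
  dif_neg h

theorem single_eq_smul_gen (t : Gen X S) (c : ℤ) :
    Finsupp.single t c = c • gen t.1.1 t.1.2 := by
  rw [gen_of_chain _ t.2, Finsupp.smul_single, smul_eq_mul, mul_one]

theorem isMChain_smul_gen (c : ℤ) (s : S) (l : List X) : IsMChain l.length (c • gen s l) := by
  by_cases h : l.IsChain (· ≠ ·)
  · rw [gen_of_chain s h, Finsupp.smul_single]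
    intro t ht
    rw [Finset.mem_singleton.1 (Finsupp.support_single_subset ht)]
  · simp [gen_of_not_chain s h, IsMChain]

/-- The boundary map as a linear map. -/
noncomputable def bdLin (op : X → X → X) (sact : S → X → S) : Ch X S →ₗ[ℤ] Ch X S :=
  Finsupp.linearCombination ℤ fun t => fOn t + gOn op sact t

theorem bd_eq (op : X → X → X) (sact : S → X → S) (γ : Ch X S) :
    bd op sact γ = bdLin op sact γ := by
  simp [bd, bdLin, fmap, gmap, Finsupp.linearCombination_apply, Finsupp.sum_add]

theorem bdLin_gen (op : X → X → X) (sact : S → X → S) (t : Gen X S) :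
    bdLin op sact (gen t.1.1 t.1.2) = fOn t + gOn op sact t := by
  rw [gen_of_chain _ t.2, bdLin, Finsupp.linearCombination_single, one_smul]

theorem bdLin_gen_three (op : X → X → X) (sact : S → X → S) (s : S) {a b c : X}
    (hab : a ≠ b) (hbc : b ≠ c) :
    bdLin op sact (gen s [a, b, c]) = -gen s [b, c] + gen s [a, c] - gen s [a, b] +
      (gen (sact s a) [b, c] - gen (sact s b) [op a b, c] +
        gen (sact s c) [op a c, op b c]) := by
  have h : [a, b, c].IsChain (· ≠ ·) := by simp [hab, hbc]
  rw [bdLin_gen op sact ⟨(s, [a, b, c]), h⟩]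
  simp only [fOn, gOn, List.length_cons, List.length_nil, Fin.sum_univ_succ]
  simp [pow_succ]
  abel

theorem bdLin_gen_four (op : X → X → X) (sact : S → X → S) (s : S) {a b c d : X}
    (hab : a ≠ b) (hbc : b ≠ c) (hcd : c ≠ d) :
    bdLin op sact (gen s [a, b, c, d]) =
      -gen s [b, c, d] + gen s [a, c, d] - gen s [a, b, d] + gen s [a, b, c] +
      (gen (sact s a) [b, c, d] - gen (sact s b) [op a b, c, d] +
        gen (sact s c) [op a c, op b c, d] - gen (sact s d) [op a d, op b d, op c d]) := by
  have h : [a, b, c, d].IsChain (· ≠ ·) := by simp [hab, hbc, hcd]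
  rw [bdLin_gen op sact ⟨(s, [a, b, c, d]), h⟩]
  simp only [fOn, gOn, List.length_cons, List.length_nil, Fin.sum_univ_succ]
  simp [pow_succ]
  abel

/-- The action of a map of quandles and a map of sets on generating tuples. -/
def Gen.map {φ : X → X} (hφ : Function.Injective φ) (ρ : S → S) (t : Gen X S) : Gen X S :=
  ⟨(ρ t.1.1, t.1.2.map φ), (List.isChain_map φ).2 (t.2.imp fun _ _ h => hφ.ne h)⟩

theorem Gen.map_injective {φ : X → X} (hφ : Function.Injective φ) {ρ : S → S}
    (hρ : Function.Injective ρ) : Function.Injective (Gen.map hφ ρ) := by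
  rintro ⟨⟨s, l⟩, h⟩ ⟨⟨s', l'⟩, h'⟩ heq
  have heq := congrArg Subtype.val heq
  obtain rfl := hρ (congrArg Prod.fst heq)
  obtain rfl := List.map_injective_iff.2 hφ (congrArg Prod.snd heq)
  rfl

theorem lmapDomain_gen {φ : X → X} (hφ : Function.Injective φ) (ρ : S → S) (s : S) (l : List X) :
    Finsupp.lmapDomain ℤ ℤ (Gen.map hφ ρ) (gen s l) = gen (ρ s) (l.map φ) := by
  by_cases h : l.IsChain (· ≠ ·)
  · rw [gen_of_chain s h, gen_of_chain (l := l.map φ) (ρ s) (Gen.map hφ ρ ⟨(s, l), h⟩).2]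
    exact Finsupp.mapDomain_single
  · rw [gen_of_not_chain s h, gen_of_not_chain, map_zero]
    exact fun h' => h (((List.isChain_map φ).1 h').imp fun _ _ hne => fun heq => hne (heq ▸ rfl))

theorem bdLin_lmapDomain {op : X → X → X} {sact : S → X → S} {φ : X → X}
    (hφ : Function.Injective φ) {ρ : S → S} (hop : ∀ a b, φ (op a b) = op (φ a) (φ b))
    (hact : ∀ s a, ρ (sact s a) = sact (ρ s) (φ a)) (γ : Ch X S) :
    bdLin op sact (Finsupp.lmapDomain ℤ ℤ (Gen.map hφ ρ) γ) =
      Finsupp.lmapDomain ℤ ℤ (Gen.map hφ ρ) (bdLin op sact γ) := by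
  rw [← LinearMap.comp_apply, ← LinearMap.comp_apply]
  congr 1
  refine Finsupp.lhom_ext fun t c => ?_
  rw [single_eq_smul_gen, map_smul, map_smul, LinearMap.comp_apply, LinearMap.comp_apply,
    lmapDomain_gen, bdLin_gen]
  refine congrArg (c • ·) ?_
  have hf : fOn (Gen.map hφ ρ t) = Finsupp.lmapDomain ℤ ℤ (Gen.map hφ ρ) (fOn t) := by
    rw [fOn, fOn, map_sum]
    refine Fintype.sum_equiv (finCongr (List.length_map φ)) _ _ fun j => ?_
    rw [map_smul, lmapDomain_gen]
    simp [Gen.map, List.eraseIdx_map]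
  have hg : gOn op sact (Gen.map hφ ρ t) =
      Finsupp.lmapDomain ℤ ℤ (Gen.map hφ ρ) (gOn op sact t) := by
    rw [gOn, gOn, map_sum]
    refine Fintype.sum_equiv (finCongr (List.length_map φ)) _ _ fun j => ?_
    rw [map_smul, lmapDomain_gen]
    simp [Gen.map, hact, hop, List.map_take, List.map_drop, Function.comp_def]
  rw [map_add, ← hf, ← hg]
  exact bdLin_gen op sact (Gen.map hφ ρ t)

/-- A signed generating `3`-tuple of `R₇` of unspecified degree; the residues are represented by
natural numbers and `sgn` is the exponent of the sign. -/
structure STerm where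
  sgn : ℕ
  idx : ℕ
  fst : ℕ
  snd : ℕ
  trd : ℕ
deriving DecidableEq

namespace STerm

/-- The code of the signed pair `(-1)ˢ (v; x, y)`. -/
def face (s v x y : ℕ) : ℕ := 2 * (49 * v + 7 * x + y) + s

/-- The code of the negative of a signed pair. -/
def opp (e : ℕ) : ℕ := e + 1 - 2 * (e % 2)

/-- The operation of `R₇` on representatives. -/
def refl (a b : ℕ) : ℕ := (2 * b + 7 - a) % 7

/-- The codes of the signed pairs of `f t`. -/
def fF : STerm → List ℕ
  | ⟨s, v, a, b, c⟩ => face (1 - s) v b c :: face (1 - s) v a b ::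
      if a = c then [] else [face s v a c]

/-- The codes of the signed pairs of `g t`. -/
def gF : STerm → List ℕ
  | ⟨s, v, a, b, c⟩ => face s (refl v a) b c :: face s (refl v c) (refl a c) (refl b c) ::
      if refl a b = c then [] else [face (1 - s) (refl v b) (refl a b) c]

/-- Add a signed pair to a list of signed pairs, cancelling it if possible. -/
def ins (e : ℕ) (l : List ℕ) : List ℕ := if opp e ∈ l then l.erase (opp e) else e :: l

/-- All terms `t` such that `e` occurs in `f t`. -/
def cands (e : ℕ) : List STerm :=
  let s := e % 2
  let v := e / 98
  let x := e / 14 % 7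
  let y := e / 2 % 7
  (List.range 7).flatMap fun w =>
    (if w = x then [] else [⟨1 - s, v, w, x, y⟩]) ++
    (if w = x ∨ w = y then [] else [⟨s, v, x, w, y⟩]) ++
    (if w = y then [] else [⟨1 - s, v, x, y, w⟩])

/-- Check `P (M ++ acc)` for all lists `M` of `k` terms such that `f M` cancels `R`; the answer is
`false` if the search gets stuck at an `f`-cycle with at least two terms missing. -/
def search (P : List STerm → Bool) : ℕ → List ℕ → List STerm → Bool
  | 0, [], acc => P acc
  | 0, _ :: _, _ => true
  | k + 1, [], _ => k == 0
  | k + 1, e :: R, acc =>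
    if 3 * (k + 1) < R.length + 1 then true else
      (cands (opp e)).all fun t => search P k ((fF t).foldr ins (e :: R)) (t :: acc)

/-- The nondegenerate terms among the given ones. -/
def nondeg (L : List STerm) : List STerm := L.filter fun t => t.fst ≠ t.snd ∧ t.snd ≠ t.trd

/-- The terms of `f` of the signed tuple `(-1)ˢ (v; a, b, c, d)`. -/
def f4 (s v a b c d : ℕ) : List STerm :=
  nondeg [⟨1 - s, v, b, c, d⟩, ⟨s, v, a, c, d⟩, ⟨1 - s, v, a, b, d⟩, ⟨s, v, a, b, c⟩]

/-- The terms of `g` of the signed tuple `(-1)ˢ (v; a, b, c, d)`. -/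
def g4 (s v a b c d : ℕ) : List STerm :=
  nondeg [⟨s, refl v a, b, c, d⟩, ⟨1 - s, refl v b, refl a b, c, d⟩,
    ⟨s, refl v c, refl a c, refl b c, d⟩, ⟨1 - s, refl v d, refl a d, refl b d, refl c d⟩]

/-- `L₀` and `L₁` are the terms of the boundary of `(0; 0, 1, 0, w)` or `-(0; w, 0, 1, 0)`. -/
def good (L₀ L₁ : List STerm) : Bool := [2, 3, 4, 5, 6].any fun w =>
  (L₀.isPerm (f4 0 0 0 1 0 w) && L₁.isPerm (g4 0 0 0 1 0 w)) ||
    (L₀.isPerm (f4 1 0 w 0 1 0) && L₁.isPerm (g4 1 0 w 0 1 0))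

/-- Every cycle with `3` terms of lower degree, among them `(0; 0, 1, 0)`, and `4` terms of upper
degree is the boundary of a generator. -/
theorem search_eq_true :
    search (fun L₀ => search (fun L₁ => !((L₁.flatMap gF).foldr ins []).isEmpty || good L₀ L₁) 4
      ((L₀.flatMap gF).foldr ins []) []) 2 ((fF ⟨0, 0, 0, 1, 0⟩).foldr ins [])
      [⟨0, 0, 0, 1, 0⟩] = true := by
  decide +kernel

/-- A term is valid if it represents a nondegenerate signed tuple. -/
structure Valid (t : STerm) : Prop where
  sgn_lt : t.sgn < 2
  idx_lt : t.idx < 7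
  fst_lt : t.fst < 7
  snd_lt : t.snd < 7
  trd_lt : t.trd < 7
  fst_ne : t.fst ≠ t.snd
  snd_ne : t.snd ≠ t.trd

/-- The chain of pairs represented by a list of codes of signed pairs. -/
noncomputable def val (L : List ℕ) : ℕ →₀ ℤ :=
  (L.map fun e => Finsupp.single (e / 2) ((-1) ^ e)).sum

@[simp] theorem val_nil : val [] = 0 := rfl

@[simp] theorem val_cons (e : ℕ) (L : List ℕ) :
    val (e :: L) = Finsupp.single (e / 2) ((-1) ^ e) + val L := rfl

@[simp] theorem val_append (L M : List ℕ) : val (L ++ M) = val L + val M := by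
  simp [val]

theorem single_opp (e : ℕ) :
    Finsupp.single (opp e / 2) ((-1 : ℤ) ^ opp e) = -Finsupp.single (e / 2) ((-1) ^ e) := by
  rw [← Finsupp.single_neg]
  obtain ⟨k, rfl | rfl⟩ := e.even_or_odd'
  · rw [show opp (2 * k) = 2 * k + 1 by unfold opp; omega, show (2 * k + 1) / 2 = 2 * k / 2 by omega]
    simp [pow_add]
  · rw [show opp (2 * k + 1) = 2 * k by unfold opp; omega,
      show 2 * k / 2 = (2 * k + 1) / 2 by omega]
    simp [pow_add]

theorem opp_opp (e : ℕ) : opp (opp e) = e := by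
  unfold opp; omega

theorem val_ins (e : ℕ) (L : List ℕ) : val (ins e L) = val (e :: L) := by
  unfold ins
  split_ifs with h
  · have h₁ : val L = val (opp e :: L.erase (opp e)) :=
      ((List.perm_cons_erase h).map _).sum_eq
    rw [val_cons e L, h₁, val_cons, single_opp]
    abel
  · rfl

theorem val_foldr_ins (L M : List ℕ) : val (L.foldr ins M) = val L + val M := by
  induction L with
  | nil => simp
  | cons e L ih => rw [List.foldr_cons, val_ins, val_cons, val_cons, ih, add_assoc]

/-- A list of codes without cancelling pairs. -/
def Reduced (L : List ℕ) : Prop := ∀ e ∈ L, opp e ∉ L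

theorem Reduced.ins {L : List ℕ} (h : Reduced L) (e : ℕ) : Reduced (ins e L) := by
  unfold STerm.ins
  split_ifs with he
  · exact fun x hx hx' => h x (List.mem_of_mem_erase hx) (List.mem_of_mem_erase hx')
  · intro x hx hx'
    have hne : opp e ≠ e := by unfold opp; omega
    rcases List.mem_cons.1 hx with rfl | hx <;> rcases List.mem_cons.1 hx' with hx' | hx'
    · exact hne hx'
    · exact he hx'
    · exact he (by rwa [← hx', opp_opp])
    · exact h x hx hx'

theorem Reduced.foldr_ins {M : List ℕ} (h : Reduced M) (L : List ℕ) :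
    Reduced (L.foldr STerm.ins M) := by
  induction L with
  | nil => exact h
  | cons e L ih => exact ih.ins e

theorem val_apply (L : List ℕ) (c : ℕ) :
    val L c = (L.count (2 * c) : ℤ) - L.count (2 * c + 1) := by
  induction L with
  | nil => simp
  | cons e L ih =>
    rw [val_cons, Finsupp.add_apply, ih, List.count_cons, List.count_cons, Finsupp.single_apply]
    obtain ⟨k, rfl | rfl⟩ := e.even_or_odd'
    · have h₁ : 2 * k / 2 = k := by omega
      have h₂ : 2 * k ≠ 2 * c + 1 := by omega
      rcases eq_or_ne k c with rfl | hk
      · simp [h₁]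
        ring
      · simp [h₁, h₂, hk]
    · have h₁ : (2 * k + 1) / 2 = k := by omega
      have h₂ : 2 * k + 1 ≠ 2 * c := by omega
      rcases eq_or_ne k c with rfl | hk
      · simp [h₁, pow_add]
        ring
      · simp [h₁, h₂, hk]

theorem count_opp {L : List ℕ} (h : val L = 0) (e : ℕ) : L.count (opp e) = L.count e := by
  have h₁ := val_apply L (e / 2)
  rw [h, Finsupp.zero_apply] at h₁
  obtain ⟨k, rfl | rfl⟩ := e.even_or_odd'
  · rw [show 2 * k / 2 = k by omega] at h₁
    rw [show opp (2 * k) = 2 * k + 1 by unfold opp; omega]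
    omega
  · rw [show (2 * k + 1) / 2 = k by omega] at h₁
    rw [show opp (2 * k + 1) = 2 * k by unfold opp; omega]
    omega

theorem Reduced.eq_nil {L : List ℕ} (hL : Reduced L) (h : val L = 0) : L = [] := by
  refine List.eq_nil_iff_forall_not_mem.2 fun e he => hL e he ?_
  rw [← List.count_pos_iff, count_opp h]
  exact List.count_pos_iff.2 he

theorem even_length {L : List ℕ} (h : val L = 0) : Even L.length := by
  have key : ∀ M : List ℕ,
      Finsupp.liftAddHom (fun _ : ℕ => Int.castAddHom (ZMod 2)) (val M) = M.length := by
    intro M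
    induction M with
    | nil => simp
    | cons e M ih =>
      rw [val_cons, map_add, ih, Finsupp.liftAddHom_apply_single, List.length_cons]
      rcases neg_one_pow_eq_or ℤ e with h | h <;> simp [h, add_comm]
  have := key L
  rw [h, map_zero] at this
  exact (ZMod.natCast_eq_zero_iff_even).1 this.symm

/-- A reduced list cancelled by `D` is, up to signs, a sublist of `D` up to order. -/
theorem Reduced.map_opp_subperm {R D : List ℕ} (hR : Reduced R) (h : val D + val R = 0) :
    (R.map opp).Subperm D := by
  rw [List.subperm_ext_iff]
  intro x hx
  obtain ⟨e, he, rfl⟩ := List.mem_map.1 hx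
  have h₁ := count_opp (L := D ++ R) (by rw [val_append, h]) e
  rw [List.count_append, List.count_append, List.count_eq_zero.2 (hR e he)] at h₁
  rw [List.count_map_of_injective R opp (Function.LeftInverse.injective opp_opp)]
  omega

theorem length_fF_le (t : STerm) : (fF t).length ≤ 3 := by
  simp only [fF]
  split_ifs <;> simp

theorem length_flatMap_fF_le (M : List STerm) : (M.flatMap fF).length ≤ 3 * M.length := by
  induction M with
  | nil => simp
  | cons t M ih =>
    have := length_fF_le t
    simp only [List.flatMap_cons, List.length_append, List.length_cons]
    omega

theorem mem_cands {t : STerm} (ht : t.Valid) {e : ℕ} (he : e ∈ fF t) : t ∈ cands e := by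
  obtain ⟨s, v, a, b, c⟩ := t
  obtain ⟨hs, hv, ha, hb, hc, hab, hbc⟩ := ht
  simp only at hs hv ha hb hc hab hbc
  have decode : ∀ s v x y, s < 2 → x < 7 → y < 7 → face s v x y % 2 = s ∧
      face s v x y / 98 = v ∧ face s v x y / 14 % 7 = x ∧ face s v x y / 2 % 7 = y := by
    intro s v x y hs hx hy
    unfold face
    omega
  have hs' : 1 - (1 - s) = s := by omega
  simp only [fF, List.mem_cons] at he
  simp only [cands, List.mem_flatMap, List.mem_range]
  rcases he with rfl | rfl | he
  · obtain ⟨h₁, h₂, h₃, h₄⟩ := decode (1 - s) v b c (by omega) hb hc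
    exact ⟨a, ha, by simp [h₁, h₂, h₃, h₄, hs', hab]⟩
  · obtain ⟨h₁, h₂, h₃, h₄⟩ := decode (1 - s) v a b (by omega) ha hb
    exact ⟨c, hc, by simp [h₁, h₂, h₃, h₄, hs', hbc.symm]⟩
  · split_ifs at he with hac
    · simp at he
    · obtain rfl := List.mem_singleton.1 he
      obtain ⟨h₁, h₂, h₃, h₄⟩ := decode s v a c hs ha hc
      exact ⟨b, hb, by simp [h₁, h₂, h₃, h₄, hab.symm, hbc]⟩

theorem val_fF_ne_zero {t : STerm} (ht : t.Valid) : val (fF t) ≠ 0 := by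
  intro h
  have hR : Reduced (fF t) := by
    obtain ⟨s, v, a, b, c⟩ := t
    obtain ⟨hs, hv, ha, hb, hc, hab, hbc⟩ := ht
    simp only at hs hv ha hb hc hab hbc
    simp only [fF]
    intro x hx hx'
    split_ifs at hx hx' <;> simp only [List.mem_cons, List.not_mem_nil, or_false] at hx hx' <;>
      unfold opp face at * <;> omega
  have := hR.eq_nil h
  simp [fF] at this

theorem exists_perm_of_search {P : List STerm → Bool} {k : ℕ} {R : List ℕ} {acc : List STerm}
    (h : search P k R acc = true) (hR : Reduced R) {M : List STerm} (hM : ∀ t ∈ M, t.Valid)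
    (hk : M.length = k) (hval : val (M.flatMap fF) + val R = 0) :
    ∃ L, L.Perm (M ++ acc) ∧ P L = true := by
  induction k generalizing R acc M with
  | zero =>
    obtain rfl := List.length_eq_zero_iff.1 hk
    obtain rfl := hR.eq_nil (by simpa using hval)
    exact ⟨acc, .refl _, by simpa [search] using h⟩
  | succ k ih =>
    cases R with
    | nil =>
      obtain rfl : k = 0 := by simpa [search] using h
      obtain ⟨t, rfl⟩ := List.length_eq_one_iff.1 hk
      exact absurd (by simpa using hval) (val_fF_ne_zero (hM t (by simp)))
    | cons e R =>
      have hsub := hR.map_opp_subperm hval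
      have hlen : ¬ 3 * (k + 1) < R.length + 1 := by
        have h₁ := hsub.length_le
        have h₂ := length_flatMap_fF_le M
        rw [List.length_map, List.length_cons] at h₁
        omega
      rw [search, if_neg hlen, List.all_eq_true] at h
      obtain ⟨t, htM, het⟩ := List.mem_flatMap.1 (hsub.subset (a := opp e) (by simp))
      have hp := List.perm_cons_erase htM
      obtain ⟨L, hL, hPL⟩ := ih (h t (mem_cands (hM t htM) het)) (hR.foldr_ins (fF t))
        (M := M.erase t) (fun x hx => hM x (List.mem_of_mem_erase hx))
        (by rw [List.length_erase_of_mem htM, hk]; rfl)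
        (by
          have h₁ : val (M.flatMap fF) = val (fF t) + val ((M.erase t).flatMap fF) := by
            rw [← val_append, ← List.flatMap_cons]
            exact ((hp.flatMap_right fF).map _).sum_eq
          rw [val_foldr_ins, ← hval, h₁]
          abel)
      exact ⟨L, hL.trans (List.perm_middle.trans (hp.symm.append_right acc)), hPL⟩

theorem exists_perm_good {M₀ M₁ : List STerm} (hM₀ : ∀ t ∈ M₀, t.Valid)
    (hM₁ : ∀ t ∈ M₁, t.Valid) (h₀ : M₀.length = 2) (h₁ : M₁.length = 4)
    (hf : val ((⟨0, 0, 0, 1, 0⟩ :: M₀).flatMap fF) = 0)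
    (hfg : val (M₁.flatMap fF) + val ((⟨0, 0, 0, 1, 0⟩ :: M₀).flatMap gF) = 0)
    (hg : val (M₁.flatMap gF) = 0) :
    ∃ L₀ L₁, L₀.Perm (⟨0, 0, 0, 1, 0⟩ :: M₀) ∧ L₁.Perm M₁ ∧ good L₀ L₁ = true := by
  have reduced_nil : Reduced [] := fun e he => absurd he List.not_mem_nil
  obtain ⟨L₀, hL₀, h⟩ := exists_perm_of_search search_eq_true (reduced_nil.foldr_ins _) hM₀ h₀ (by
    rw [List.flatMap_cons, val_append] at hf
    rw [val_foldr_ins, val_nil, add_zero, ← hf, add_comm])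
  replace hL₀ := hL₀.trans (List.perm_append_singleton _ _)
  obtain ⟨L₁, hL₁, h⟩ := exists_perm_of_search h (reduced_nil.foldr_ins _) hM₁ h₁ (by
    rw [val_foldr_ins, val_nil, add_zero, ← hfg]
    exact congrArg _ ((hL₀.flatMap_right gF).map _).sum_eq)
  rw [List.append_nil] at hL₁
  refine ⟨L₀, L₁, hL₀, hL₁, ?_⟩
  have : (L₁.flatMap gF).foldr ins [] = [] := by
    refine (reduced_nil.foldr_ins _).eq_nil ?_
    rw [val_foldr_ins, val_nil, add_zero, ← hg]
    exact ((hL₁.flatMap_right gF).map _).sum_eq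
  simpa [this] using h

/-- The chain of degree `m` represented by a signed term. -/
noncomputable def chain (m : ℤ) (t : STerm) : Ch (ZMod 7) (ℤ × ZMod 7) :=
  (-1 : ℤ) ^ t.sgn •
    gen (m, (t.idx : ZMod 7)) [(t.fst : ZMod 7), (t.snd : ZMod 7), (t.trd : ZMod 7)]

/-- The chain of degree `m` represented by a list of signed terms. -/
noncomputable def chains (m : ℤ) (L : List STerm) : Ch (ZMod 7) (ℤ × ZMod 7) :=
  (L.map (chain m)).sum

@[simp] theorem chains_nil (m : ℤ) : chains m [] = 0 := rfl

@[simp] theorem chains_cons (m : ℤ) (t : STerm) (L : List STerm) :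
    chains m (t :: L) = chain m t + chains m L := rfl

theorem chains_perm (m : ℤ) {L M : List STerm} (h : L.Perm M) : chains m L = chains m M :=
  (h.map _).sum_eq

theorem chains_nondeg (m : ℤ) (L : List STerm) : chains m (nondeg L) = chains m L := by
  induction L with
  | nil => rfl
  | cons t L ih =>
    rw [chains_cons, ← ih, nondeg, nondeg, List.filter_cons]
    split_ifs with h
    · rfl
    · have : chain m t = 0 := by
        rw [chain, gen_of_not_chain, smul_zero]
        intro h'
        simp only [List.isChain_cons_cons, ne_eq] at h'
        exact h (by simpa using ⟨fun he => h'.1 (by rw [he]), fun he => h'.2.1 (by rw [he])⟩)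
      rw [this, zero_add]

theorem natCast_inj {a b : ℕ} (ha : a < 7) (hb : b < 7) : (a : ZMod 7) = b ↔ a = b := by
  rw [ZMod.natCast_eq_natCast_iff', Nat.mod_eq_of_lt ha, Nat.mod_eq_of_lt hb]

theorem refl_lt (a b : ℕ) : refl a b < 7 := Nat.mod_lt _ (by norm_num)

theorem natCast_refl {a b : ℕ} (ha : a < 7) : ((refl a b : ℕ) : ZMod 7) = R7op a b := by
  have : ((7 : ℕ) : ZMod 7) = 0 := ZMod.natCast_self 7
  rw [refl, ZMod.natCast_mod, Nat.cast_sub (by omega), Nat.cast_add, this, R7op]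
  push_cast
  ring

theorem neg_one_pow_one_sub {s : ℕ} (hs : s < 2) : (-1 : ℤ) ^ (1 - s) = -(-1) ^ s := by
  interval_cases s <;> rfl

/-- The code of a pair as a basis element. -/
noncomputable def pairCode (v : ZMod 7) : List (ZMod 7) → ℕ →₀ ℤ
  | [x, y] => Finsupp.single (49 * v.val + 7 * x.val + y.val) 1
  | _ => 0

/-- The part of degree `k` of a chain of pairs. -/
noncomputable def pairPart (k : ℤ) : Ch (ZMod 7) (ℤ × ZMod 7) →ₗ[ℤ] ℕ →₀ ℤ :=
  Finsupp.linearCombination ℤ fun t => if t.1.1.1 = k then pairCode t.1.1.2 t.1.2 else 0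

theorem pairPart_gen_of_ne {k m : ℤ} (h : m ≠ k) (v : ZMod 7) (l : List (ZMod 7)) :
    pairPart k (gen (m, v) l) = 0 := by
  by_cases hl : l.IsChain (· ≠ ·)
  · rw [gen_of_chain _ hl, pairPart, Finsupp.linearCombination_single]
    simp [h]
  · rw [gen_of_not_chain _ hl, map_zero]

theorem pairPart_gen (m : ℤ) {s v x y : ℕ} (hv : v < 7) (hx : x < 7) (hy : y < 7) (hs : s < 2) :
    (-1 : ℤ) ^ s • pairPart m (gen (m, (v : ZMod 7)) [(x : ZMod 7), (y : ZMod 7)]) =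
      val (if x = y then [] else [face s v x y]) := by
  split_ifs with h
  · rw [gen_of_not_chain, map_zero, smul_zero, val_nil]
    simp [h]
  · have hl : [(x : ZMod 7), (y : ZMod 7)].IsChain (· ≠ ·) := by
      simpa [natCast_inj hx hy] using h
    have h₁ : face s v x y / 2 = 49 * v + 7 * x + y := by unfold face; omega
    rw [gen_of_chain _ hl, pairPart, Finsupp.linearCombination_single, val_cons, val_nil, h₁]
    simp [pairCode, Nat.mod_eq_of_lt, hv, hx, hy, face, pow_add, pow_mul]

theorem pairPart_fF (m : ℤ) {t : STerm} (ht : t.Valid) :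
    (-1 : ℤ) ^ t.sgn • pairPart m (-gen (m, (t.idx : ZMod 7)) [(t.snd : ZMod 7), (t.trd : ZMod 7)] +
      gen (m, (t.idx : ZMod 7)) [(t.fst : ZMod 7), (t.trd : ZMod 7)] -
      gen (m, (t.idx : ZMod 7)) [(t.fst : ZMod 7), (t.snd : ZMod 7)]) = val (fF t) := by
  obtain ⟨s, v, a, b, c⟩ := t
  obtain ⟨hs, hv, ha, hb, hc, hab, hbc⟩ := ht
  simp only at hs hv ha hb hc hab hbc ⊢
  have h₁ := pairPart_gen m (s := 1 - s) hv hb hc (by omega)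
  have h₂ := pairPart_gen m (s := 1 - s) hv ha hb (by omega)
  have h₃ := pairPart_gen m hv ha hc hs
  rw [neg_one_pow_one_sub hs, neg_smul] at h₁ h₂
  rw [if_neg hbc] at h₁
  rw [if_neg hab] at h₂
  simp only [fF, val_cons, map_add, map_sub, map_neg, smul_add, smul_sub, smul_neg]
  rw [← h₃, h₁, sub_eq_add_neg, h₂]
  simp only [val_cons, val_nil]
  abel

theorem pairPart_gF (m : ℤ) {t : STerm} (ht : t.Valid) :
    (-1 : ℤ) ^ t.sgn • pairPart m
      (gen (m, R7op t.idx t.fst) [(t.snd : ZMod 7), (t.trd : ZMod 7)] -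
        gen (m, R7op t.idx t.snd) [R7op t.fst t.snd, (t.trd : ZMod 7)] +
        gen (m, R7op t.idx t.trd) [R7op t.fst t.trd, R7op t.snd t.trd]) = val (gF t) := by
  obtain ⟨s, v, a, b, c⟩ := t
  obtain ⟨hs, hv, ha, hb, hc, hab, hbc⟩ := ht
  simp only at hs hv ha hb hc hab hbc ⊢
  have h₁ := pairPart_gen m (refl_lt v a) hb hc hs
  have h₂ := pairPart_gen m (s := 1 - s) (refl_lt v b) (refl_lt a b) hc (by omega)
  have h₃ := pairPart_gen m (refl_lt v c) (refl_lt a c) (refl_lt b c) hs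
  have hne : refl a c ≠ refl b c := by unfold refl; omega
  rw [neg_one_pow_one_sub hs, neg_smul] at h₂
  rw [if_neg hbc] at h₁
  rw [if_neg hne] at h₃
  simp only [natCast_refl, ha, hb, hv] at h₁ h₂ h₃
  simp only [gF, val_cons, map_add, map_sub, smul_add, smul_sub]
  rw [← h₂, h₁, h₃]
  simp only [val_cons, val_nil]
  abel

theorem pairPart_bdLin_chain (k m : ℤ) {t : STerm} (ht : t.Valid) :
    pairPart k (bdLin R7op (zact R7op) (chain m t)) =
      (if m = k then val (fF t) else 0) + if m + 1 = k then val (gF t) else 0 := by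
  rw [chain, map_smul, map_smul, bdLin_gen_three _ _ _
    ((natCast_inj ht.fst_lt ht.snd_lt).not.2 ht.fst_ne)
    ((natCast_inj ht.snd_lt ht.trd_lt).not.2 ht.snd_ne), map_add, smul_add]
  congr 1
  · split_ifs with h
    · rw [← h, pairPart_fF m ht]
    · simp [pairPart_gen_of_ne h]
  · simp only [zact]
    split_ifs with h
    · rw [← h, pairPart_gF (m + 1) ht]
    · simp [pairPart_gen_of_ne h]

theorem pairPart_bdLin_chains (k m : ℤ) {L : List STerm} (hL : ∀ t ∈ L, t.Valid) :
    pairPart k (bdLin R7op (zact R7op) (chains m L)) =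
      (if m = k then val (L.flatMap fF) else 0) +
        if m + 1 = k then val (L.flatMap gF) else 0 := by
  induction L with
  | nil => simp
  | cons t L ih =>
    rw [chains_cons, map_add, map_add, ih fun t ht => hL t (List.mem_cons_of_mem _ ht),
      pairPart_bdLin_chain k m (hL t List.mem_cons_self), List.flatMap_cons, List.flatMap_cons,
      val_append, val_append]
    split_ifs <;> abel

theorem bdLin_four (m : ℤ) {s v a b c d : ℕ} (hs : s < 2) (hv : v < 7) (ha : a < 7) (hb : b < 7)
    (hc : c < 7) (hd : d < 7) (hab : a ≠ b) (hbc : b ≠ c) (hcd : c ≠ d) :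
    bdLin R7op (zact R7op) ((-1 : ℤ) ^ s •
        gen (m, (v : ZMod 7)) [(a : ZMod 7), (b : ZMod 7), (c : ZMod 7), (d : ZMod 7)]) =
      chains m (f4 s v a b c d) + chains (m + 1) (g4 s v a b c d) := by
  rw [map_smul, bdLin_gen_four _ _ _ ((natCast_inj ha hb).not.2 hab) ((natCast_inj hb hc).not.2 hbc)
    ((natCast_inj hc hd).not.2 hcd), f4, g4, chains_nondeg, chains_nondeg]
  simp only [chains_cons, chains_nil, chain, neg_one_pow_one_sub hs, natCast_refl, ha, hb, hc, hv,
    zact]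
  module

theorem exists_bdLin_eq_of_good {L₀ L₁ : List STerm} (h : good L₀ L₁ = true) (m : ℤ) :
    ∃ (σ : ℤ) (s : ℤ × ZMod 7) (a b c d : ZMod 7),
      bdLin R7op (zact R7op) (σ • gen s [a, b, c, d]) = chains m L₀ + chains (m + 1) L₁ := by
  rw [good, List.any_eq_true] at h
  obtain ⟨w, hw, h⟩ := h
  obtain ⟨hw₁, hw₂⟩ : 1 < w ∧ w < 7 := by
    simp only [List.mem_cons, List.not_mem_nil, or_false] at hw
    omega
  simp only [Bool.or_eq_true, Bool.and_eq_true, List.isPerm_iff] at h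
  rcases h with ⟨h₀, h₁⟩ | ⟨h₀, h₁⟩ <;> rw [chains_perm m h₀, chains_perm (m + 1) h₁]
  · exact ⟨_, _, _, _, _, _, bdLin_four m (by omega) (by omega) (by omega) (by omega) (by omega)
      hw₂ (by omega) (by omega) (by omega)⟩
  · exact ⟨_, _, _, _, _, _, bdLin_four m (by omega) (by omega) hw₂ (by omega) (by omega)
      (by omega) (by omega) (by omega) (by omega)⟩

theorem exists_bdLin_eq {M₀ M₁ : List STerm} (hM₀ : ∀ t ∈ M₀, t.Valid)
    (hM₁ : ∀ t ∈ M₁, t.Valid) (h₀ : M₀.length = 2) (h₁ : M₁.length = 4)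
    (hcyc : bdLin R7op (zact R7op) (chains 0 (⟨0, 0, 0, 1, 0⟩ :: M₀) + chains 1 M₁) = 0) :
    ∃ (σ : ℤ) (s : ℤ × ZMod 7) (a b c d : ZMod 7),
      bdLin R7op (zact R7op) (σ • gen s [a, b, c, d]) =
        chains 0 (⟨0, 0, 0, 1, 0⟩ :: M₀) + chains 1 M₁ := by
  have hv : ∀ t ∈ (⟨0, 0, 0, 1, 0⟩ :: M₀ : List STerm), t.Valid :=
    List.forall_mem_cons.2 ⟨by constructor <;> norm_num, hM₀⟩
  have key (k : ℤ) := congrArg (pairPart k) hcyc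
  simp only [map_add, map_zero, pairPart_bdLin_chains _ _ hv, pairPart_bdLin_chains _ _ hM₁] at key
  obtain ⟨L₀, L₁, hL₀, hL₁, h⟩ := exists_perm_good hM₀ hM₁ h₀ h₁ (by simpa using key 0)
    (by simpa [add_comm] using key 1) (by simpa using key 2)
  obtain ⟨σ, s, a, b, c, d, h⟩ := exists_bdLin_eq_of_good h 0
  exact ⟨σ, s, a, b, c, d, by rw [h, chains_perm 0 hL₀, zero_add, chains_perm 1 hL₁]⟩

theorem exists_mem_fst_eq_trd {L : List STerm} (h : val (L.flatMap fF) = 0)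
    (hL : Odd L.length) : ∃ t ∈ L, t.fst = t.trd := by
  by_contra! hne
  have h₁ : (L.flatMap fF).length = 3 * L.length := by
    rw [List.length_flatMap, List.map_congr_left (g := fun _ => 3)
      fun t ht => by simp [fF, hne t ht]]
    simp [mul_comm]
  exact (Nat.not_even_iff_odd.2 ((by decide : Odd 3).mul hL)) (h₁ ▸ even_length h)

theorem exists_chains_eq_single {m : ℤ} {t : Gen (ZMod 7) (ℤ × ZMod 7)} (ht : t.1.1.1 = m)
    (hl : t.1.2.length = 3) (c : ℤ) :
    ∃ L : List STerm, (∀ t ∈ L, t.Valid) ∧ L.length = c.natAbs ∧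
      chains m L = Finsupp.single t c := by
  obtain ⟨⟨⟨m', v⟩, l⟩, h⟩ := t
  obtain ⟨x, y, z, rfl⟩ := List.length_eq_three.1 hl
  obtain rfl : m' = m := ht
  have hval : ∀ s < 2, Valid ⟨s, v.val, x.val, y.val, z.val⟩ := by
    have h' : [x, y, z].IsChain (· ≠ ·) := h
    simp only [List.isChain_cons_cons] at h'
    exact fun s hs => ⟨hs, v.val_lt, x.val_lt, y.val_lt, z.val_lt,
      (ZMod.val_injective 7).ne h'.1, (ZMod.val_injective 7).ne h'.2.1⟩
  refine ⟨List.replicate c.natAbs ⟨if c < 0 then 1 else 0, v.val, x.val, y.val, z.val⟩, ?_, by simp,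
    ?_⟩
  · intro t ht
    rw [List.eq_of_mem_replicate ht]
    exact hval _ (by split_ifs <;> norm_num)
  · rw [single_eq_smul_gen, chains, List.map_replicate, List.sum_replicate, chain]
    simp only [ZMod.natCast_zmod_val, ← natCast_zsmul, smul_smul]
    congr 1
    split_ifs with hc <;> push_cast
    · rw [abs_of_neg hc]; ring
    · rw [abs_of_nonneg (not_lt.1 hc)]; ring

theorem exists_chains_eq_sum {m : ℤ} {s : Finset (Gen (ZMod 7) (ℤ × ZMod 7))}
    (hs : ∀ t ∈ s, t.1.1.1 = m ∧ t.1.2.length = 3) (γ : Ch (ZMod 7) (ℤ × ZMod 7)) :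
    ∃ L : List STerm, (∀ t ∈ L, t.Valid) ∧ L.length = ∑ t ∈ s, (γ t).natAbs ∧
      chains m L = ∑ t ∈ s, Finsupp.single t (γ t) := by
  classical
  induction s using Finset.induction_on with
  | empty => exact ⟨[], by simp⟩
  | insert t s hts ih =>
    obtain ⟨L, hL, hlen, hsum⟩ := ih fun t' ht' => hs t' (Finset.mem_insert_of_mem ht')
    obtain ⟨ht, hl⟩ := hs t (Finset.mem_insert_self _ _)
    obtain ⟨L', hL', hlen', hsum'⟩ := exists_chains_eq_single ht hl (γ t)
    refine ⟨L' ++ L, fun t' ht' => (List.mem_append.1 ht').elim (hL' t') (hL t'), ?_, ?_⟩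
    · rw [List.length_append, hlen, hlen', Finset.sum_insert hts]
    · rw [chains, List.map_append, List.sum_append, ← chains, ← chains, hsum, hsum',
        Finset.sum_insert hts]

theorem exists_chains_add_eq {γ : Ch (ZMod 7) (ℤ × ZMod 7)} {n : ℤ} (h3 : IsMChain 3 γ)
    (hlen : chainLen γ = Tcount γ n + Tcount γ (n + 1)) :
    ∃ L₀ L₁ : List STerm, (∀ t ∈ L₀, t.Valid) ∧ (∀ t ∈ L₁, t.Valid) ∧
      L₀.length = Tcount γ n ∧ L₁.length = Tcount γ (n + 1) ∧
      chains n L₀ + chains (n + 1) L₁ = γ := by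
  have hT : ∀ k, Tcount γ k = ∑ t ∈ γ.support with t.1.1.1 = k, (γ t).natAbs :=
    fun k => (Finset.sum_filter _ _).symm
  have hdeg : ∀ t ∈ γ.support, t.1.1.1 = n ∨ t.1.1.1 = n + 1 := by
    by_contra! h
    obtain ⟨t, ht, htn, htn'⟩ := h
    refine hlen.not_gt ?_
    simp only [Tcount, chainLen, Finsupp.sum, ← Finset.sum_add_distrib]
    refine Finset.sum_lt_sum (fun x _ => ?_) ⟨t, ht, ?_⟩
    · split_ifs <;> omega
    · simpa [htn, htn'] using ht
  obtain ⟨L₀, hL₀, hl₀, hs₀⟩ := exists_chains_eq_sum (m := n)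
    (s := {t ∈ γ.support | t.1.1.1 = n}) (γ := γ) fun t ht =>
      ⟨(Finset.mem_filter.1 ht).2, h3 t (Finset.mem_filter.1 ht).1⟩
  obtain ⟨L₁, hL₁, hl₁, hs₁⟩ := exists_chains_eq_sum (m := n + 1)
    (s := {t ∈ γ.support | t.1.1.1 = n + 1}) (γ := γ) fun t ht =>
      ⟨(Finset.mem_filter.1 ht).2, h3 t (Finset.mem_filter.1 ht).1⟩
  refine ⟨L₀, L₁, hL₀, hL₁, by rw [hl₀, hT], by rw [hl₁, hT], ?_⟩
  rw [hs₀, hs₁]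
  conv_rhs => rw [← γ.sum_single, Finsupp.sum]
  rw [← Finset.sum_filter_add_sum_filter_not γ.support (fun t => t.1.1.1 = n)]
  congr 2
  refine Finset.filter_congr fun t ht => ⟨fun h => by omega, (hdeg t ht).resolve_left⟩

theorem exists_chain_eq {φ : ZMod 7 → ZMod 7} (hφ : Function.Bijective φ)
    {ρ : ℤ × ZMod 7 → ℤ × ZMod 7} {m m' : ℤ} (hρ : ∀ v, ∃ w, ρ (m, w) = (m', v)) (s : ℕ)
    {t : STerm} (ht : t.Valid) :
    ∃ t' : STerm, t'.Valid ∧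
      chain m' t = (-1 : ℤ) ^ s • Finsupp.lmapDomain ℤ ℤ (Gen.map hφ.1 ρ) (chain m t') := by
  obtain ⟨w, hw⟩ := hρ t.idx
  obtain ⟨x, hx⟩ := hφ.2 t.fst
  obtain ⟨y, hy⟩ := hφ.2 t.snd
  obtain ⟨z, hz⟩ := hφ.2 t.trd
  refine ⟨⟨(t.sgn + s) % 2, w.val, x.val, y.val, z.val⟩, ⟨Nat.mod_lt _ two_pos, w.val_lt, x.val_lt,
    y.val_lt, z.val_lt, (ZMod.val_injective 7).ne ?_, (ZMod.val_injective 7).ne ?_⟩, ?_⟩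
  · rintro rfl
    exact ht.fst_ne ((natCast_inj ht.fst_lt ht.snd_lt).1 (hx.symm.trans hy))
  · rintro rfl
    exact ht.snd_ne ((natCast_inj ht.snd_lt ht.trd_lt).1 (hy.symm.trans hz))
  · have hsgn : (-1 : ℤ) ^ s * (-1) ^ ((t.sgn + s) % 2) = (-1) ^ t.sgn := by
      rw [← neg_one_pow_eq_pow_mod_two, pow_add, mul_left_comm, ← mul_pow]
      simp
    simp only [chain, map_smul, lmapDomain_gen, smul_smul, hsgn, ZMod.natCast_zmod_val, hw,
      List.map_cons, List.map_nil, hx, hy, hz]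

theorem exists_chains_eq {φ : ZMod 7 → ZMod 7} (hφ : Function.Bijective φ)
    {ρ : ℤ × ZMod 7 → ℤ × ZMod 7} {m m' : ℤ} (hρ : ∀ v, ∃ w, ρ (m, w) = (m', v)) (s : ℕ)
    {L : List STerm} (hL : ∀ t ∈ L, t.Valid) :
    ∃ L' : List STerm, (∀ t ∈ L', t.Valid) ∧ L'.length = L.length ∧
      chains m' L = (-1 : ℤ) ^ s • Finsupp.lmapDomain ℤ ℤ (Gen.map hφ.1 ρ) (chains m L') := by
  induction L with
  | nil => exact ⟨[], by simp⟩
  | cons t L ih =>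
    obtain ⟨L', hL', hlen, h⟩ := ih fun t ht => hL t (List.mem_cons_of_mem _ ht)
    obtain ⟨t', ht', h'⟩ := exists_chain_eq hφ hρ s (hL t List.mem_cons_self)
    refine ⟨t' :: L', List.forall_mem_cons.2 ⟨ht', hL'⟩, by simp [hlen], ?_⟩
    rw [chains_cons, chains_cons, map_add, smul_add, h, h']

end STerm

/-- a 3-cycle of `(R₇, ℤ × R₇)` of length `7` with `|T_n| = 3` and
`|T_{n+1}| = 4` is a 3-boundary. -/
theorem cycle_R7_three_four_is_boundary (γ : Ch (ZMod 7) (ℤ × ZMod 7)) (n : ℤ)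
    (h3 : IsMChain 3 γ) (hcyc : bd R7op (zact R7op) γ = 0) (hlen : chainLen γ = 7)
    (hmin : MinDegree γ n) (hTn : Tcount γ n = 3) (hTn1 : Tcount γ (n + 1) = 4) :
    ∃ δ : Ch (ZMod 7) (ℤ × ZMod 7), IsMChain 4 δ ∧ bd R7op (zact R7op) δ = γ := by
  obtain ⟨L₀, L₁, hL₀, hL₁, hl₀, hl₁, rfl⟩ :=
    STerm.exists_chains_add_eq (n := n) h3 (by rw [hlen, hTn, hTn1])
  rw [hTn] at hl₀
  rw [hTn1] at hl₁
  simp only [bd_eq] at hcyc ⊢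
  obtain ⟨⟨s, u, a, b, c⟩, ht, hac⟩ := STerm.exists_mem_fst_eq_trd (L := L₀)
    (by
      have := congrArg (STerm.pairPart n) hcyc
      simpa [STerm.pairPart_bdLin_chains _ _ hL₀, STerm.pairPart_bdLin_chains _ _ hL₁,
        show n + 1 + 1 ≠ n by omega] using this)
    (by rw [hl₀]; decide)
  obtain rfl : a = c := hac
  have hab : (b : ZMod 7) - a ≠ 0 := sub_ne_zero.2 fun h =>
    (hL₀ _ ht).fst_ne ((STerm.natCast_inj (hL₀ _ ht).snd_lt (hL₀ _ ht).fst_lt).1 h).symm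
  have : Fact (Nat.Prime 7) := ⟨by norm_num⟩
  let φ : ZMod 7 → ZMod 7 := fun x => a + (b - a) * x
  let ρ : ℤ × ZMod 7 → ℤ × ZMod 7 := fun p =>
    (p.1 + n, a + (b - a) * p.2 + ((p.1.negOnePow : ℤ) : ZMod 7) * (u - a))
  have hφ : Function.Bijective φ := Finite.injective_iff_bijective.1 fun x y h => by
    simpa [φ, hab] using h
  have hρ : Function.Injective ρ := by
    rintro ⟨m, v⟩ ⟨m', v'⟩ h
    simp only [ρ, Prod.mk.injEq, add_left_inj] at h
    obtain ⟨rfl, h⟩ := h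
    simpa [hab] using h
  have hρ' : ∀ m v, ∃ w, ρ (m, w) = (m + n, v) := fun m v =>
    ⟨(v - a - ((m.negOnePow : ℤ) : ZMod 7) * (u - a)) / (b - a), by
      simp only [ρ, mul_div_cancel₀ _ hab]
      congr 1
      ring⟩
  have hop : ∀ x y, φ (R7op x y) = R7op (φ x) (φ y) := fun x y => by
    simp only [φ, R7op]
    ring
  have hact : ∀ p x, ρ (zact R7op p x) = zact R7op (ρ p) (φ x) := fun p x => by
    simp only [ρ, φ, zact, R7op, Int.negOnePow_succ]
    push_cast
    refine Prod.ext (by ring) ?_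
    simp only
    ring
  have hinj : Function.Injective (Finsupp.lmapDomain ℤ ℤ (Gen.map hφ.1 ρ)) :=
    Finsupp.mapDomain_injective (Gen.map_injective hφ.1 hρ)
  have hunit : (-1 : ℤ) ^ s ≠ 0 := pow_ne_zero _ (by norm_num)
  have hp := List.perm_cons_erase ht
  obtain ⟨M₀, hM₀, hm₀, h₀⟩ := STerm.exists_chains_eq hφ (fun v => zero_add n ▸ hρ' 0 v) s
    (L := L₀.erase ⟨s, u, a, b, a⟩) fun t ht => hL₀ t (List.mem_of_mem_erase ht)
  obtain ⟨M₁, hM₁, hm₁, h₁⟩ := STerm.exists_chains_eq hφ (fun v => add_comm 1 n ▸ hρ' 1 v) s hL₁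
  have hγ : STerm.chains n L₀ + STerm.chains (n + 1) L₁ = (-1 : ℤ) ^ s •
      Finsupp.lmapDomain ℤ ℤ (Gen.map hφ.1 ρ)
        (STerm.chains 0 (⟨0, 0, 0, 1, 0⟩ :: M₀) + STerm.chains 1 M₁) := by
    rw [STerm.chains_perm n hp, STerm.chains_cons, STerm.chains_cons, h₀, h₁, map_add, map_add,
      smul_add, smul_add]
    congr 2
    rw [STerm.chain, STerm.chain, map_smul, lmapDomain_gen]
    simp [φ, ρ]
  rw [hγ, map_smul, bdLin_lmapDomain hφ.1 hop hact, smul_eq_zero_iff_right hunit,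
    map_eq_zero_iff _ hinj] at hcyc
  obtain ⟨σ, p, x, y, z, w, h⟩ := STerm.exists_bdLin_eq hM₀ hM₁
    (by rw [hm₀, List.length_erase_of_mem ht, hl₀]) (hm₁.trans hl₁) hcyc
  refine ⟨((-1 : ℤ) ^ s * σ) • gen (ρ p) [φ x, φ y, φ z, φ w], isMChain_smul_gen _ _ _, ?_⟩
  rw [hγ, ← h, ← bdLin_lmapDomain hφ.1 hop hact, map_smul, map_smul, map_smul, lmapDomain_gen,
    smul_smul]
  rfl

end QHom
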